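/- Let f_i : N_{i-1} → ℝᵏ, i = 1, ..., n, be continuous maps between unit h-sets N_{i-1}, N_i (all with the same u, s, u + s = k, and with c_{N_i} = Id) such that N_{i-1} f_i-covers N_i, and set N_n = N₀. Then there exists x ∈ int N₀ with f_i ∘ ⋯ ∘ f₁(x) ∈ int N_i for i = 1, ..., n and f_n ∘ ⋯ ∘ f₁(x) = x. -/

import Mathlib

open Set Metric

/-- Support of the standard unit h-set in `ℝᵘ × ℝˢ`. -/
def unitHSet (u s : ℕ) : Set (EuclideanSpace ℝ (Fin u) × EuclideanSpace ℝ (Fin s)) :=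
  Metric.closedBall 0 1 ×ˢ Metric.closedBall 0 1

/-- Exit set `N_c⁻` of the standard unit h-set. -/
def unitHSetMinus (u s : ℕ) :
    Set (EuclideanSpace ℝ (Fin u) × EuclideanSpace ℝ (Fin s)) :=
  Metric.sphere 0 1 ×ˢ Metric.closedBall 0 1

/-- Entry set `N_c⁺` of the standard unit h-set. -/
def unitHSetPlus (u s : ℕ) :
    Set (EuclideanSpace ℝ (Fin u) × EuclideanSpace ℝ (Fin s)) :=
  Metric.closedBall 0 1 ×ˢ Metric.sphere 0 1

/-- `N f-covers M` for the standard unit h-sets (with `c_N = c_M = Id`): there is a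
continuous homotopy `h` with `h₀ = f`, `h([0,1] × N_c⁻) ∩ M_c = ∅`,
`h([0,1] × N_c) ∩ M_c⁺ = ∅`, and if `u > 0` then `h₁(p,q) = (A p, 0)` for a linear map
`A` sending the unit sphere outside the closed unit ball, while if `u = 0` then
`h₁ ≡ 0`. -/
def UnitCovers (u s : ℕ)
    (f : EuclideanSpace ℝ (Fin u) × EuclideanSpace ℝ (Fin s) →
      EuclideanSpace ℝ (Fin u) × EuclideanSpace ℝ (Fin s)) : Prop :=
  ∃ h : ℝ → EuclideanSpace ℝ (Fin u) × EuclideanSpace ℝ (Fin s) →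
      EuclideanSpace ℝ (Fin u) × EuclideanSpace ℝ (Fin s),
    ContinuousOn (fun p : ℝ × _ => h p.1 p.2) (Set.Icc (0 : ℝ) 1 ×ˢ unitHSet u s) ∧
    (∀ x ∈ unitHSet u s, h 0 x = f x) ∧
    (∀ l ∈ Set.Icc (0 : ℝ) 1, ∀ x ∈ unitHSetMinus u s, h l x ∉ unitHSet u s) ∧
    (∀ l ∈ Set.Icc (0 : ℝ) 1, ∀ x ∈ unitHSet u s, h l x ∉ unitHSetPlus u s) ∧
    (0 < u → ∃ A : EuclideanSpace ℝ (Fin u) →ₗ[ℝ] EuclideanSpace ℝ (Fin u),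
      (∀ p, ‖p‖ = 1 → 1 < ‖A p‖) ∧ ∀ x ∈ unitHSet u s, h 1 x = (A x.1, 0)) ∧
    (u = 0 → ∀ x ∈ unitHSet u s, h 1 x = 0)

open Polynomial in
lemma det_poly {F : Type*} [NormedAddCommGroup F] [NormedSpace ℝ F] [FiniteDimensional ℝ F]
    (B : F →L[ℝ] F) : ∃ P : ℝ[X], P.degree < (Module.finrank ℝ F + 1 : ℕ) ∧
      ∀ t : ℝ, P.eval t = (ContinuousLinearMap.id ℝ F + t • B).det := by
  let b := Module.finBasis ℝ F
  let M := LinearMap.toMatrix b b (B : F →ₗ[ℝ] F)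
  refine ⟨Matrix.det ((X : ℝ[X]) • M.map C + (1 : Matrix _ _ ℝ).map C), ?_, ?_⟩
  · refine lt_of_le_of_lt Polynomial.degree_le_natDegree ?_
    have := natDegree_det_X_add_C_le M 1
    rw [Fintype.card_fin] at this
    exact_mod_cast Nat.lt_succ_of_le this
  · intro t
    have h1 : (ContinuousLinearMap.id ℝ F + t • B).det
        = Matrix.det (LinearMap.toMatrix b b
          ((ContinuousLinearMap.id ℝ F + t • B : F →L[ℝ] F) : F →ₗ[ℝ] F)) := by
      rw [LinearMap.det_toMatrix]
    have h2 : LinearMap.toMatrix b b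
          ((ContinuousLinearMap.id ℝ F + t • B : F →L[ℝ] F) : F →ₗ[ℝ] F) = 1 + t • M := by
      rw [ContinuousLinearMap.toLinearMap_add, ContinuousLinearMap.toLinearMap_smul, map_add, map_smul]
      congr 1
      exact LinearMap.toMatrix_id b
    rw [h1, h2, ← Polynomial.coe_evalRingHom, RingHom.map_det]
    congr 1
    ext i j
    simp [Matrix.add_apply, Matrix.one_apply, add_comm]
    split_ifs <;> simp [mul_comm]

open Polynomial in
lemma interp (d : ℕ) (v : ℕ → ℝ) (hv : Function.Injective v) : ∃ c : ℕ → ℝ, ∀ P : ℝ[X],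
    P.degree < (d + 1 : ℕ) → P.eval 1 = ∑ j ∈ Finset.range (d + 1), c j * P.eval (v j) := by
  refine ⟨fun j => (Lagrange.basis (Finset.range (d+1)) v j).eval 1, fun P hP => ?_⟩
  have := Lagrange.eq_interpolate (s := Finset.range (d+1)) (v := v) (f := P) hv.injOn
    (by simpa using hP)
  conv_lhs => rw [this]
  rw [Lagrange.interpolate_apply, Polynomial.eval_finsetSum]
  simp [mul_comm]

lemma det_pos_small {F : Type*} [NormedAddCommGroup F] [NormedSpace ℝ F] [FiniteDimensional ℝ F]
    (B : F →L[ℝ] F) (t : ℝ) (ht : 0 ≤ t) (h : t * ‖B‖ < 1) :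
    0 < (ContinuousLinearMap.id ℝ F + t • B).det := by
  by_contra hcon
  push Not at hcon
  have hc : ContinuousOn (fun s : ℝ => (ContinuousLinearMap.id ℝ F + s • B).det) (Icc 0 t) := by
    apply Continuous.continuousOn
    exact ContinuousLinearMap.continuous_det.comp (by fun_prop)
  have h0 : (ContinuousLinearMap.id ℝ F + (0:ℝ) • B).det = 1 := by
    rw [zero_smul, add_zero]; exact LinearMap.det_id
  obtain ⟨s, hs, hs0⟩ := intermediate_value_Icc' ht hc (show (0:ℝ) ∈ _ from ⟨hcon, by rw [h0]; norm_num⟩)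
  have := LinearMap.bot_lt_ker_of_det_eq_zero (f := ((ContinuousLinearMap.id ℝ F + s • B : F →L[ℝ] F) : F →ₗ[ℝ] F)) hs0
  obtain ⟨x, hx, hx0⟩ := (Submodule.ne_bot_iff _).1 this.ne'
  have hx1 : x + s • B x = 0 := by simpa using hx
  have h2 : ‖x‖ = s * ‖B x‖ := by
    rw [eq_neg_of_add_eq_zero_left hx1, norm_neg, norm_smul, Real.norm_of_nonneg hs.1]
    rw [← eq_neg_of_add_eq_zero_left hx1]
  have h3 := B.le_opNorm x
  have h4 : 0 < ‖x‖ := norm_pos_iff.2 hx0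
  have h5 : s * ‖B x‖ ≤ t * (‖B‖ * ‖x‖) := mul_le_mul hs.2 h3 (norm_nonneg _) ht
  nlinarith

lemma lip_indicator {F : Type*} [NormedAddCommGroup F] [NormedSpace ℝ F]
    (φ : F → F) (R : ℝ) (C : NNReal) (hφ : LipschitzOnWith C φ (closedBall 0 R))
    (h0 : ∀ x, ‖x‖ = R → φ x = 0) : LipschitzWith C ((closedBall (0:F) R).indicator φ) := by
  have key : ∀ x y, ‖x‖ ≤ R → R < ‖y‖ → dist (φ x) 0 ≤ C * dist x y := by
    intro x y hx hy
    have hc : ContinuousOn (fun t : ℝ => ‖AffineMap.lineMap x y t‖) (Icc 0 1) := by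
      apply Continuous.continuousOn
      exact (AffineMap.lineMap_continuous).norm
    obtain ⟨t, ht, htR⟩ := intermediate_value_Icc zero_le_one hc
      (show R ∈ _ from ⟨by simpa using hx, by simpa using hy.le⟩)
    simp only at htR
    have := hφ.dist_le_mul x (by simpa using hx) (AffineMap.lineMap x y t) (by simp [htR])
    rw [h0 _ htR] at this
    refine this.trans (mul_le_mul_of_nonneg_left ?_ C.2)
    rw [dist_left_lineMap, Real.norm_of_nonneg ht.1]
    exact mul_le_of_le_one_left dist_nonneg ht.2
  refine LipschitzWith.of_dist_le_mul fun x y => ?_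
  by_cases hx : x ∈ closedBall (0:F) R <;> by_cases hy : y ∈ closedBall (0:F) R
  · rw [indicator_of_mem hx, indicator_of_mem hy]; exact hφ.dist_le_mul x hx y hy
  · rw [indicator_of_mem hx, indicator_of_notMem hy]
    exact key x y (by simpa using hx) (by simpa using hy)
  · rw [indicator_of_notMem hx, indicator_of_mem hy, dist_comm, dist_comm x y]
    exact key y x (by simpa using hy) (by simpa using hx)
  · rw [indicator_of_notMem hx, indicator_of_notMem hy, dist_self]
    exact mul_nonneg C.2 dist_nonneg

open MeasureTheory in
lemma no_retract {F : Type*} [NormedAddCommGroup F] [InnerProductSpace ℝ F] [FiniteDimensional ℝ F]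
    (r : F → F) (hr : ContDiff ℝ 1 r) (R : ℝ) (hR : 0 < R) (hid : ∀ x, ‖x‖ = R → r x = x)
    (hn : ∀ x, ‖r x‖ = R) : False := by
  borelize F
  set φ : F → F := fun x => r x - x with hφdef
  have hφ : ContDiff ℝ 1 φ := hr.sub contDiff_id
  have hφd : Differentiable ℝ φ := hφ.differentiable (by norm_num)
  obtain ⟨C0, hC0⟩ := (isCompact_closedBall (0:F) R).exists_bound_of_continuousOn
    (hφ.continuous_fderiv (by norm_num)).continuousOn
  set C : NNReal := C0.toNNReal with hC
  have hCb : ∀ x ∈ closedBall (0:F) R, ‖fderiv ℝ φ x‖ ≤ C := fun x hx =>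
    (hC0 x hx).trans (Real.le_coe_toNNReal _)
  have hlip : LipschitzOnWith C φ (closedBall 0 R) :=
    Convex.lipschitzOnWith_of_nnnorm_fderiv_le (𝕜 := ℝ) (fun x _ => hφd x) hCb (convex_closedBall _ _)
  have hlip' := lip_indicator φ R C hlip (fun x hx => by simp [hφdef, hid x hx])
  have hC' : (0:ℝ) ≤ C := C.2

  have main : ∀ t : ℝ, 0 < t → t < 1 → t * C < 1 →
      IntegrableOn (fun x => (ContinuousLinearMap.id ℝ F + t • fderiv ℝ φ x).det) (ball 0 R) ∧
      ∫ x in ball (0:F) R, (ContinuousLinearMap.id ℝ F + t • fderiv ℝ φ x).det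
        = volume.real (ball (0:F) R) := by
    intro t ht0 ht1 htC
    set ψ := (closedBall (0:F) R).indicator φ with hψ
    have hcontr : ∀ y : F, ContractingWith (t.toNNReal * C) (fun x => y - t • ψ x) := by
      intro y
      refine ⟨?_, ?_⟩
      · rw [← NNReal.coe_lt_coe]; simpa [ht0.le] using htC
      · refine LipschitzWith.of_dist_le_mul fun a b => ?_
        have := hlip'.dist_le_mul a b
        rw [dist_sub_left, dist_smul₀, Real.norm_of_nonneg ht0.le]
        push_cast
        rw [Real.coe_toNNReal _ ht0.le, mul_assoc]
        gcongr
    have hψb : ∀ x ∈ ball (0:F) R, ψ x = φ x := fun x hx => indicator_of_mem (ball_subset_closedBall hx) _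
    have hinj : InjOn (fun x => x + t • φ x) (ball 0 R) := by
      intro a ha b hb hab
      simp only at hab
      refine (hcontr (a + t • φ a)).fixedPoint_unique' ?_ ?_
      · simp [Function.IsFixedPt, hψb a ha]
      · simp [Function.IsFixedPt, hψb b hb, hab]
    have himg : (fun x => x + t • φ x) '' (ball 0 R) = ball 0 R := by
      apply Subset.antisymm
      · rintro _ ⟨x, hx, rfl⟩
        have : x + t • φ x = (1 - t) • x + t • r x := by simp only [hφdef]; module
        simp only [mem_ball_zero_iff] at hx ⊢
        rw [this]
        refine (norm_add_le _ _).trans_lt ?_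
        rw [norm_smul, norm_smul, hn, Real.norm_of_nonneg ht0.le, Real.norm_of_nonneg (by linarith)]
        nlinarith
      · intro y hy
        have hfix := (hcontr y).fixedPoint_isFixedPt
        set x := ContractingWith.fixedPoint _ (hcontr y)
        have hx : y - t • ψ x = x := hfix
        have hyx : x + t • ψ x = y := (sub_eq_iff_eq_add.1 hx).symm
        by_cases hxb : x ∈ ball (0:F) R
        · exact ⟨x, hxb, by simp only; rw [← hψb x hxb, hyx]⟩
        · exfalso
          have : ψ x = 0 := by
            by_cases hxc : x ∈ closedBall (0:F) R
            · rw [hψ, indicator_of_mem hxc]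
              have : ‖x‖ = R := by
                simp at hxb hxc; linarith
              simp [hφdef, hid x this]
            · exact indicator_of_notMem hxc _
          rw [this] at hyx
          simp at hyx
          exact hxb (hyx ▸ hy)
    have hd : ∀ x ∈ ball (0:F) R, HasFDerivWithinAt (fun x => x + t • φ x)
        (ContinuousLinearMap.id ℝ F + t • fderiv ℝ φ x) (ball 0 R) x := fun x _ =>
      ((hasFDerivAt_id x).add ((hφd x).hasFDerivAt.const_smul t)).hasFDerivWithinAt
    have hpos : ∀ x ∈ ball (0:F) R, |(ContinuousLinearMap.id ℝ F + t • fderiv ℝ φ x).det|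
        = (ContinuousLinearMap.id ℝ F + t • fderiv ℝ φ x).det := fun x hx => by
      apply abs_of_pos
      apply det_pos_small _ _ ht0.le
      exact lt_of_le_of_lt (mul_le_mul_of_nonneg_left (hCb x (ball_subset_closedBall hx)) ht0.le) htC
    have i1 := integrableOn_image_iff_integrableOn_abs_det_fderiv_smul volume measurableSet_ball hd hinj
      (fun _ => (1:ℝ))
    have i2 := integral_image_eq_integral_abs_det_fderiv_smul volume measurableSet_ball hd hinj
      (fun _ => (1:ℝ))
    rw [himg] at i1 i2
    simp only [smul_eq_mul, mul_one] at i1 i2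
    constructor
    · refine (integrableOn_congr_fun hpos measurableSet_ball).1 (i1.1 ?_)
      exact integrableOn_const (by exact measure_ball_lt_top.ne)
    · rw [setIntegral_congr_fun measurableSet_ball hpos] at i2
      rw [← i2]; simp
  set v : ℕ → ℝ := fun j => ((C + 1) * (j + 2))⁻¹ with hv
  have hvinj : Function.Injective v := by
    intro a b hab
    have h1 : ((C:ℝ) + 1) * (a + 2) = (C + 1) * (b + 2) := inv_injective hab
    have h2 := mul_left_cancel₀ (by positivity) h1
    exact_mod_cast add_right_cancel h2
  have hvm : ∀ j, 0 < v j ∧ v j < 1 ∧ v j * C < 1 := by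
    intro j
    have hj : (0:ℝ) ≤ j := Nat.cast_nonneg j
    refine ⟨by positivity, inv_lt_one_of_one_lt₀ (by nlinarith), ?_⟩
    simp only [hv]
    rw [inv_mul_lt_iff₀ (by positivity)]
    nlinarith
  obtain ⟨c, hc⟩ := interp (Module.finrank ℝ F) v hvinj
  have hcsum : ∑ j ∈ Finset.range (Module.finrank ℝ F + 1), c j = 1 := by
    have := hc 1 (by rw [Polynomial.degree_one]; exact_mod_cast Nat.succ_pos _)
    simpa using this.symm
  have hzero : ∀ x ∈ ball (0:F) R, ∑ j ∈ Finset.range (Module.finrank ℝ F + 1),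
      c j * (ContinuousLinearMap.id ℝ F + v j • fderiv ℝ φ x).det = 0 := by
    intro x hx
    obtain ⟨P, hP, hPe⟩ := det_poly (fderiv ℝ φ x)
    have h1 := hc P hP
    simp only [hPe] at h1
    rw [← h1, one_smul]
    have hrd : DifferentiableAt ℝ r x := hr.differentiable (by norm_num) x
    have h2 : ContinuousLinearMap.id ℝ F + fderiv ℝ φ x = fderiv ℝ r x := by
      have : fderiv ℝ φ x = fderiv ℝ r x - ContinuousLinearMap.id ℝ F := by
        have h := (hrd.hasFDerivAt.sub (hasFDerivAt_id x)).fderiv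
        exact h
      rw [this]; abel
    rw [h2]
    by_contra hdet
    have hsurj : Function.Surjective (fderiv ℝ r x) :=
      (LinearMap.equivOfDetNeZero ((fderiv ℝ r x : F →L[ℝ] F) : F →ₗ[ℝ] F) hdet).surjective
    obtain ⟨w, hw⟩ := hsurj (r x)
    have h3 : HasFDerivAt (fun y => inner ℝ (r y) (r y)) _ x := hrd.hasFDerivAt.inner ℝ hrd.hasFDerivAt
    have h4 : (fun y => inner ℝ (r y) (r y)) = fun _ => R ^ 2 := by
      funext y; rw [real_inner_self_eq_norm_sq, hn]
    rw [h4] at h3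
    have h5 := h3.unique (hasFDerivAt_const _ _)
    have h6 := congrArg (fun l => l w) h5
    simp [hw, hn] at h6
    exact hR.ne' h6
  have hintg : ∫ x in ball (0:F) R, ∑ j ∈ Finset.range (Module.finrank ℝ F + 1),
      c j * (ContinuousLinearMap.id ℝ F + v j • fderiv ℝ φ x).det = 0 := by
    rw [setIntegral_congr_fun measurableSet_ball hzero]; simp
  rw [integral_finsetSum] at hintg
  · have : ∀ j ∈ Finset.range (Module.finrank ℝ F + 1), ∫ x in ball (0:F) R,
        c j * (ContinuousLinearMap.id ℝ F + v j • fderiv ℝ φ x).det = c j * volume.real (ball (0:F) R) := by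
      intro j _
      rw [integral_const_mul, (main (v j) (hvm j).1 (hvm j).2.1 (hvm j).2.2).2]
    rw [Finset.sum_congr rfl this, ← Finset.sum_mul, hcsum, one_mul] at hintg
    have hp : 0 < volume.real (ball (0:F) R) :=
      ENNReal.toReal_pos (measure_ball_pos _ _ hR).ne' measure_ball_lt_top.ne
    exact hp.ne' hintg
  · intro j _
    exact (main (v j) (hvm j).1 (hvm j).2.1 (hvm j).2.2).1.const_mul _

lemma exists_zero_eucl {F : Type*} [NormedAddCommGroup F] [InnerProductSpace ℝ F]
    [FiniteDimensional ℝ F] (g : F → F) (hg : Continuous g) (R : ℝ) (hR : 0 < R)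
    (hid : ∀ x, R ≤ ‖x‖ → g x = x) : ∃ x, g x = 0 := by
  by_contra! hne
  obtain ⟨p, hp⟩ : ∃ δ > 0, ∀ x, δ ≤ ‖g x‖ := by
    obtain ⟨x0, -, hx0⟩ := (isCompact_closedBall (0:F) R).exists_isMinOn ⟨0, by simp [hR.le]⟩
      hg.norm.continuousOn
    refine ⟨min R ‖g x0‖, lt_min hR (norm_pos_iff.2 (hne x0)), fun x => ?_⟩
    rcases le_total R ‖x‖ with h | h
    · rw [hid x h]; exact (min_le_left _ _).trans h
    · exact (min_le_right _ _).trans (hx0 (by simpa using h))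
  obtain ⟨hp0, hp⟩ := hp
  obtain ⟨k, hk, hka, hks⟩ := Continuous.exists_contDiff_approx (f := fun x => g x - x)
    (ε := fun _ => p) 1 (by fun_prop) continuous_const (fun _ => hp0)
  have hk0 : ∀ x, R ≤ ‖x‖ → k x = 0 := by
    intro x hx
    by_contra h
    exact hks h (by simp [hid x hx])
  have hg' : ∀ x, x + k x ≠ 0 := by
    intro x hx
    have := hka x
    rw [eq_neg_of_add_eq_zero_right hx, dist_eq_norm] at this
    have h2 : -x - (g x - x) = - g x := by abel
    rw [h2, norm_neg] at this
    linarith [hp x]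
  have hk' : ContDiff ℝ 1 (fun x => x + k x) := contDiff_id.add hk
  refine no_retract (fun x => (R * ‖x + k x‖⁻¹) • (x + k x)) ?_ R hR ?_ ?_
  · exact (contDiff_const.mul ((hk'.norm ℝ hg').inv (fun x => norm_ne_zero_iff.2 (hg' x)))).smul hk'
  · intro x hx
    simp only [hk0 x hx.ge, add_zero, hx]
    rw [mul_inv_cancel₀ hR.ne', one_smul]
  · intro x
    have := norm_pos_iff.2 (hg' x)
    rw [norm_smul, norm_mul, norm_inv, norm_norm, mul_assoc, inv_mul_cancel₀ this.ne', mul_one,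
      Real.norm_of_nonneg hR.le]

lemma exists_zero_normed {E : Type*} [NormedAddCommGroup E] [NormedSpace ℝ E]
    [FiniteDimensional ℝ E] (g : E → E) (hg : Continuous g)
    (hid : ∀ x, 1 ≤ ‖x‖ → g x = x) : ∃ x, g x = 0 := by
  let e : EuclideanSpace ℝ (Fin (Module.finrank ℝ E)) ≃L[ℝ] E :=
    ContinuousLinearEquiv.ofFinrankEq (by simp)
  obtain ⟨x, hx⟩ := exists_zero_eucl (fun x => e.symm (g (e x)))
    (e.symm.continuous.comp (hg.comp e.continuous)) (‖(e.symm : E →L[ℝ] EuclideanSpace ℝ (Fin (Module.finrank ℝ E)))‖ + 1) (by positivity) (by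
      intro x hx
      have h1 := (e.symm : E →L[ℝ] EuclideanSpace ℝ (Fin (Module.finrank ℝ E))).le_opNorm (e x)
      simp only [ContinuousLinearEquiv.coe_coe, ContinuousLinearEquiv.symm_apply_apply] at h1
      have : 1 ≤ ‖e x‖ := by
        by_contra! h
        have := mul_le_of_le_one_right (norm_nonneg (e.symm : E →L[ℝ] EuclideanSpace ℝ (Fin (Module.finrank ℝ E)))) h.le
        linarith
      simp [hid _ this])
  exact ⟨e x, by simpa using hx⟩

/-- Leray–Schauder style continuation on the unit ball of a finite-dimensional normed space. -/
lemma homotopy_zero {E : Type*} [NormedAddCommGroup E] [NormedSpace ℝ E]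
    [FiniteDimensional ℝ E] (H : ℝ → E → E)
    (hH : ContinuousOn (fun p : ℝ × E => H p.1 p.2) (Icc (0:ℝ) 1 ×ˢ closedBall 0 1))
    (hb : ∀ t ∈ Icc (0:ℝ) 1, ∀ x, ‖x‖ = 1 → H t x ≠ 0)
    (L : E →ₗ[ℝ] E) (hL : Function.Injective L) (h1 : ∀ x, ‖x‖ ≤ 1 → H 1 x = L x) :
    ∃ x, ‖x‖ < 1 ∧ H 0 x = 0 := by
  let e : E ≃L[ℝ] E := (LinearEquiv.ofInjectiveEndo L hL).toContinuousLinearEquiv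
  have heL : ∀ x, e.symm (L x) = x := fun x => e.symm_apply_apply x
  set S : Set (ℝ × E) := (Icc (0:ℝ) 1 ×ˢ closedBall 0 1) ∩ (fun p : ℝ × E => H p.1 p.2) ⁻¹' {0}
  have hK : IsCompact (Icc (0:ℝ) 1 ×ˢ closedBall (0:E) 1) := isCompact_Icc.prod (isCompact_closedBall _ _)
  have hS : IsCompact S := hK.of_isClosed_subset
    (hH.preimage_isClosed_of_isClosed hK.isClosed isClosed_singleton) inter_subset_left
  have hZ : IsClosed (Prod.snd '' S) := (hS.image continuous_snd).isClosed
  obtain ⟨l, hl0, hl1, hl⟩ := exists_continuous_zero_one_of_isClosed hZ (isClosed_sphere (x := (0:E)) (ε := 1))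
    (by
      rw [disjoint_left]
      rintro _ ⟨⟨t, x⟩, ⟨⟨ht, hx⟩, h0⟩, rfl⟩ hs
      exact hb t ht x (by simpa using hs) h0)
  set π : E → E := fun x => (max 1 ‖x‖)⁻¹ • x with hπ
  have hmax : ∀ x : E, 0 < max 1 ‖x‖ := fun x => lt_max_of_lt_left one_pos
  have hπc : Continuous π :=
    ((continuous_const.max continuous_norm).inv₀ (fun x => (hmax x).ne')).smul continuous_id
  have hπn : ∀ x, ‖π x‖ = (max 1 ‖x‖)⁻¹ * ‖x‖ := fun x => by
    rw [hπ, norm_smul, Real.norm_of_nonneg (inv_nonneg.2 (hmax x).le)]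
  have hπ1 : ∀ x, ‖π x‖ ≤ 1 := fun x => by
    rw [hπn, inv_mul_le_iff₀ (hmax x)]; simp
  obtain ⟨x, hx⟩ := exists_zero_normed (fun x => e.symm (H (l (π x)) (π x)) + (x - π x)) (by
      refine (e.symm.continuous.comp ?_).add (continuous_id.sub hπc)
      exact hH.comp_continuous (f := fun x => (l (π x), π x)) ((l.continuous.comp hπc).prodMk hπc)
        (fun x => ⟨hl _, by simpa using hπ1 x⟩))
    (by
      intro x hx
      have : ‖π x‖ = 1 := by
        rw [hπn, max_eq_right hx, inv_mul_cancel₀ (by linarith)]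
      have hl' : l (π x) = 1 := hl1 (by simpa using this)
      simp only [hl', h1 _ this.le, heL]
      abel)
  have hx1 : ‖x‖ < 1 := by
    by_contra! hx1
    have : ‖π x‖ = 1 := by
      rw [hπn, max_eq_right hx1, inv_mul_cancel₀ (by linarith)]
    have hl' : l (π x) = 1 := hl1 (by simpa using this)
    simp only [hl', h1 _ this.le, heL] at hx
    have : x = 0 := by simpa using hx
    simp [this] at hx1
    linarith
  have hpx : π x = x := by simp [hπ, max_eq_left hx1.le]
  rw [hpx, sub_self, add_zero] at hx
  have hx0 : H (l x) x = 0 := by simpa using hx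
  have : l x = 0 := hl0 ⟨(l x, x), ⟨⟨hl x, by simpa using hx1.le⟩, hx0⟩, rfl⟩
  exact ⟨x, hx1, by rw [← this]; exact hx0⟩




/-- Product of the ambient spaces along the loop. -/
abbrev HSetLoopSpace (m u s : ℕ) : Type :=
  Fin (m + 1) → EuclideanSpace ℝ (Fin u) × EuclideanSpace ℝ (Fin s)

/-- Theorem 1: a closed loop of covering relations between unit h-sets yields a point
whose orbit stays in the interiors and which is periodic. -/
theorem stmt11 {u s : ℕ} (n : ℕ) (hn : 0 < n)
    (f : Fin n → (EuclideanSpace ℝ (Fin u) × EuclideanSpace ℝ (Fin s) →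
      EuclideanSpace ℝ (Fin u) × EuclideanSpace ℝ (Fin s)))
    (hfc : ∀ i, ContinuousOn (f i) (unitHSet u s))
    (hcov : ∀ i, UnitCovers u s (f i)) :
    ∃ x ∈ interior (unitHSet u s),
      ∃ y : Fin (n + 1) → EuclideanSpace ℝ (Fin u) × EuclideanSpace ℝ (Fin s),
        y 0 = x ∧
        (∀ i : Fin n, y i.succ = f i (y i.castSucc)) ∧
        (∀ i : Fin n, y i.succ ∈ interior (unitHSet u s)) ∧
        y (Fin.last n) = x := by
  obtain ⟨m, rfl⟩ : ∃ m, n = m + 1 := ⟨n - 1, by omega⟩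
  choose h hc h0 hminus hplus hA hu0 using hcov
  have hA' : ∀ i, ∃ A : EuclideanSpace ℝ (Fin u) →ₗ[ℝ] EuclideanSpace ℝ (Fin u),
      (∀ p, ‖p‖ = 1 → 1 < ‖A p‖) ∧ ∀ x ∈ unitHSet u s, h i 1 x = (A x.1, 0) := by
    intro i
    rcases Nat.eq_zero_or_pos u with hu | hu
    · subst hu
      refine ⟨0, fun p hp => ?_, fun x hx => ?_⟩
      · rw [Subsingleton.elim p 0, norm_zero] at hp; norm_num at hp
      · rw [hu0 i rfl x hx]; rfl
    · exact hA i hu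
  choose A hA1 hA2 using hA'
  have hmem : ∀ z : EuclideanSpace ℝ (Fin u) × EuclideanSpace ℝ (Fin s),
      z ∈ unitHSet u s ↔ ‖z‖ ≤ 1 := by
    intro z
    simp [unitHSet, Set.mem_prod, Prod.norm_def]
  have hAexp : ∀ i p, p ≠ 0 → ‖p‖ < ‖A i p‖ := by
    intro i p hp
    have hp' : 0 < ‖p‖ := norm_pos_iff.2 hp
    have := hA1 i (‖p‖⁻¹ • p) (by rw [norm_smul, norm_inv, norm_norm, inv_mul_cancel₀ hp'.ne'])
    rw [map_smul, norm_smul, norm_inv, norm_norm, lt_inv_mul_iff₀ hp'] at this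
    linarith
  let L : HSetLoopSpace m u s →ₗ[ℝ] HSetLoopSpace m u s :=
    { toFun := fun x i => x (i + 1) - (A i (x i).1, 0)
      map_add' := by
        intro x y; funext i
        simp only [Pi.add_apply, Pi.smul_apply, Prod.fst_add, Prod.smul_fst, map_add, map_smul, RingHom.id_apply]
        ext <;> simp <;> ring
      map_smul' := by
        intro c x; funext i
        simp only [Pi.add_apply, Pi.smul_apply, Prod.fst_add, Prod.smul_fst, map_add, map_smul, RingHom.id_apply]
        ext <;> simp <;> ring }
  have hLinj : Function.Injective L := by
    rw [injective_iff_map_eq_zero]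
    intro x hx
    have hx' : ∀ i, x (i + 1) = (A i (x i).1, 0) := fun i => sub_eq_zero.1 (congrFun hx i)
    obtain ⟨i, hi⟩ := Finite.exists_max (fun i => ‖(x i).1‖)
    have hi0 : (x i).1 = 0 := by
      by_contra hne
      have h1 := hAexp i _ hne
      have h2 := hi (i + 1)
      rw [hx' i] at h2
      simp only at h2
      linarith
    funext j
    have hj : (x j).1 = 0 := by
      have := hi j
      simp only [hi0, norm_zero] at this
      exact norm_le_zero_iff.1 this
    refine Prod.ext hj ?_
    have := hx' (j - 1)
    rw [sub_add_cancel] at this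
    rw [this]; rfl
  obtain ⟨x, hx1, hx0⟩ := homotopy_zero (E := HSetLoopSpace m u s) (fun t x i => x (i + 1) - h i t (x i))
    (by
      refine continuousOn_pi.2 fun i => ?_
      refine ContinuousOn.sub (by fun_prop) ?_
      refine (hc i).comp (f := fun p : ℝ × HSetLoopSpace m u s => (p.1, p.2 i)) (by fun_prop) ?_
      rintro ⟨t, x⟩ ⟨ht, hx⟩
      exact ⟨ht, (hmem _).2 ((norm_le_pi_norm x i).trans (by simpa using hx))⟩)
    (by
      intro t ht x hx hzero
      have hz : ∀ i, x (i + 1) = h i t (x i) := fun i => sub_eq_zero.1 (congrFun hzero i)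
      have hxm : ∀ i, x i ∈ unitHSet u s := fun i => (hmem _).2 ((norm_le_pi_norm x i).trans hx.le)
      obtain ⟨i, hi⟩ := Finite.exists_max (fun i => ‖x i‖)
      have hxi : ‖x i‖ = 1 := by
        refine le_antisymm ((hmem _).1 (hxm i)) ?_
        rw [← hx]
        exact (pi_norm_le_iff_of_nonneg (norm_nonneg _)).2 hi
      have hxi' := hxm i
      simp only [unitHSet, Set.mem_prod, mem_closedBall_zero_iff] at hxi'
      rw [Prod.norm_def] at hxi
      rcases max_choice ‖(x i).1‖ ‖(x i).2‖ with hm | hm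
      · rw [hm] at hxi
        refine hminus i t ht (x i) ?_ (hz i ▸ hxm (i + 1))
        simp [unitHSetMinus, Set.mem_prod, hxi, hxi'.2]
      · rw [hm] at hxi
        have := hz (i - 1)
        rw [sub_add_cancel] at this
        refine hplus (i - 1) t ht (x (i - 1)) (hxm _) (this ▸ ?_)
        simp [unitHSetPlus, Set.mem_prod, hxi, hxi'.1])
    L hLinj
    (by
      intro x hx
      funext i
      have := hA2 i (x i) ((hmem _).2 ((norm_le_pi_norm x i).trans hx))
      simp only [this]; rfl)
  have hintg : ∀ i, x i ∈ interior (unitHSet u s) := by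
    intro i
    refine mem_interior.2 ⟨ball 0 1, fun z hz => (hmem z).2 (mem_ball_zero_iff.1 hz).le, isOpen_ball, ?_⟩
    rw [mem_ball_zero_iff]
    exact (norm_le_pi_norm x i).trans_lt hx1
  have hz : ∀ i, x (i + 1) = f i (x i) := fun i => by
    rw [← h0 i _ (interior_subset (hintg i))]
    exact sub_eq_zero.1 (congrFun hx0 i)
  have hcast : ∀ i : Fin (m + 1), Fin.ofNat (m + 1) (i.castSucc : Fin (m + 2)).val = i := by
    intro i; ext; simp [Nat.mod_eq_of_lt i.2]
  have hsucc : ∀ i : Fin (m + 1), Fin.ofNat (m + 1) (i.succ : Fin (m + 2)).val = i + 1 := by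
    intro i; ext; simp [Fin.val_add]
  refine ⟨x 0, hintg 0, fun j => x (Fin.ofNat (m + 1) j.val), ?_, ?_, ?_, ?_⟩
  · congr 1
  · intro i
    simp only [hcast, hsucc, hz]
  · intro i; exact hintg _
  · simp only [Fin.val_last]
    congr 1
    ext; simp
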